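/- arXiv:1908.10649 — 4 statements merged into one kernel-verified Lean document; each statement's English description precedes it below -/
import Mathlib

section
/- The finite derivative test D is reasonable: for all probability measures f, g on Ω^∞, every ε ∈ (0,1/2) and every measurable set A ⊆ Ω^∞, if g(A) > 0 and f(A) < (ε/(1−ε))·g(A), then g(A ∩ R_{D,ε}^{(f,g)}) > 0; and for every ε ∈ (1/2,1) and every measurable A, if f(A) > 0 and g(A) < ((1−ε)/ε)·f(A), then f(A ∩ L_{D,ε}^{(f,g)}) > 0. -/
open MeasureTheory Filter Set
open scoped ENNReal

/-- The space Ω^∞ of infinite binary sequences. -/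
abbrev BinSeq : Type := ℕ → Bool

/-- The cylinder set `[ω^t]` of sequences agreeing with `ω` in the first `t` coordinates. -/
def cyl (ω : BinSeq) (t : ℕ) : Set BinSeq := {ω' | ∀ i < t, ω' i = ω i}

/-- A (candidate) cardinal comparison test: to each ordered pair of measures, each time `t`
and each realization `ω` it assigns a number. -/
abbrev Test : Type := Measure BinSeq → Measure BinSeq → ℕ → BinSeq → ℝ

/-- The σ-algebra on `BinSeq` generated by the first `t` coordinates. -/
def coordAlg (t : ℕ) : MeasurableSpace BinSeq :=
  MeasurableSpace.comap (fun ω (i : Fin t) => ω (i : ℕ)) inferInstance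

/-- A cardinal comparison test: values in `[0,1]`, and `T_t` is measurable with respect to the
σ-algebra generated by the first `t` coordinates, for every `t ≥ 1`. -/
def IsCCTest (T : Test) : Prop :=
  ∀ f g : Measure BinSeq, IsProbabilityMeasure f → IsProbabilityMeasure g →
    ∀ t : ℕ, 1 ≤ t →
      (∀ ω, T f g t ω ∈ Set.Icc (0:ℝ) 1) ∧ @Measurable BinSeq ℝ (coordAlg t) _ (T f g t)

/-- `L_{T,ε}^{(f,g)}`: the set of `ω` where `lim_t T_t(ω,f,g)` exists and is `> ε`. -/
def LSet (T : Test) (f g : Measure BinSeq) (ε : ℝ) : Set BinSeq :=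
  {ω | ∃ l : ℝ, Tendsto (fun t => T f g t ω) atTop (nhds l) ∧ ε < l}

/-- `R_{T,ε}^{(f,g)}`: the set of `ω` where `lim_t T_t(ω,f,g)` exists and is `< ε`. -/
def RSet (T : Test) (f g : Measure BinSeq) (ε : ℝ) : Set BinSeq :=
  {ω | ∃ l : ℝ, Tendsto (fun t => T f g t ω) atTop (nhds l) ∧ l < ε}

/-- Anonymity: `T_t(ω,f,g) = 1 - T_t(ω,g,f)`. -/
def Anonymous (T : Test) : Prop :=
  ∀ f g : Measure BinSeq, IsProbabilityMeasure f → IsProbabilityMeasure g →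
    ∀ t : ℕ, 1 ≤ t → ∀ ω, T f g t ω = 1 - T g f t ω

/-- Error-freeness. -/
def ErrorFree (T : Test) : Prop :=
  ∀ f g : Measure BinSeq, IsProbabilityMeasure f → IsProbabilityMeasure g →
    ∀ A : Set BinSeq, MeasurableSet A →
      (∀ ε : ℝ, ε ∈ Set.Ioo 0 (1/2) →
        f (A ∩ RSet T f g ε) ≤ ENNReal.ofReal (ε / (1 - ε)) * g (A ∩ RSet T f g ε)) ∧
      (∀ ε : ℝ, ε ∈ Set.Ioo (1/2) 1 →
        g (A ∩ LSet T f g ε) ≤ ENNReal.ofReal ((1 - ε) / ε) * f (A ∩ LSet T f g ε))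

/-- Reasonableness. -/
def Reasonable (T : Test) : Prop :=
  ∀ f g : Measure BinSeq, IsProbabilityMeasure f → IsProbabilityMeasure g →
    ∀ A : Set BinSeq, MeasurableSet A →
      (∀ ε : ℝ, ε ∈ Set.Ioo 0 (1/2) →
        0 < g A → f A < ENNReal.ofReal (ε / (1 - ε)) * g A →
          0 < g (A ∩ RSet T f g ε)) ∧
      (∀ ε : ℝ, ε ∈ Set.Ioo (1/2) 1 →
        0 < f A → g A < ENNReal.ofReal ((1 - ε) / ε) * f A →
          0 < f (A ∩ LSet T f g ε))

/-- The finite derivative test `D`. -/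
noncomputable def Dtest : Test := fun f g t ω =>
  match t with
  | 0 => 1/2
  | Nat.succ s =>
      if 0 < f (cyl ω s) + g (cyl ω s) then
        (f (cyl ω s)).toReal / ((f (cyl ω s)).toReal + (g (cyl ω s)).toReal)
      else 1/2


lemma cyl_eq_preimage (ω : BinSeq) (t : ℕ) :
    cyl ω t = (fun (ω' : BinSeq) (i : Fin t) => ω' i) ⁻¹' {fun i : Fin t => ω i} := by
  ext ω'
  simp only [cyl, mem_ofPred_eq, mem_preimage, mem_singleton_iff, funext_iff]
  exact ⟨fun h i => h i i.2, fun h i hi => h ⟨i, hi⟩⟩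

lemma measurable_initialSegment (t : ℕ) :
    Measurable (fun (ω : BinSeq) (i : Fin t) => ω i) :=
  measurable_pi_lambda _ fun _ => measurable_pi_apply _

lemma coordAlg_mono : Monotone coordAlg := by
  intro s t hst
  refine Measurable.comap_le ?_
  have h : (fun (ω : BinSeq) (i : Fin s) => ω i) =
      (fun (x : Fin t → Bool) (i : Fin s) => x (Fin.castLE hst i)) ∘
        (fun (ω : BinSeq) (i : Fin t) => ω i) := rfl
  rw [h]
  exact (measurable_of_finite _).comp (comap_measurable _)

/-- The filtration on `BinSeq` given by the initial segments. -/
def coordFiltration : Filtration ℕ (inferInstance : MeasurableSpace BinSeq) where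
  seq := coordAlg
  mono' := coordAlg_mono
  le' t := (measurable_initialSegment t).comap_le

lemma iSup_coordFiltration :
    ⨆ t, coordFiltration t = (inferInstance : MeasurableSpace BinSeq) := by
  refine le_antisymm (iSup_le coordFiltration.le) (iSup_le fun i => ?_)
  refine le_trans ?_ (le_iSup coordFiltration (i + 1))
  refine Measurable.comap_le ?_
  exact (measurable_pi_apply (Fin.last i)).comp
    (comap_measurable (fun (ω : BinSeq) (j : Fin (i + 1)) => ω j))

lemma Dtest_succ (f g : Measure BinSeq) [IsFiniteMeasure f] [IsFiniteMeasure g] (t : ℕ)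
    (ω : BinSeq) (h : (f + g) (cyl ω t) ≠ 0) :
    Dtest f g (t + 1) ω = f.real (cyl ω t) / (f + g).real (cyl ω t) := by
  rw [Measure.add_apply] at h
  rw [measureReal_add_apply]
  simp only [Dtest, pos_iff_ne_zero.2 h, if_true, Measure.real]

lemma Dtest_succ_eq_comp (f g : Measure BinSeq) (t : ℕ) :
    ∃ φ : (Fin t → Bool) → ℝ,
      Dtest f g (t + 1) = φ ∘ fun (ω : BinSeq) (i : Fin t) => ω i := by
  let C : (Fin t → Bool) → Set BinSeq :=
    fun x => (fun (ω : BinSeq) (i : Fin t) => ω i) ⁻¹' {x}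
  refine ⟨fun x => if 0 < f (C x) + g (C x) then
    (f (C x)).toReal / ((f (C x)).toReal + (g (C x)).toReal) else 1 / 2, ?_⟩
  ext ω
  simp [Dtest, cyl_eq_preimage, C]

lemma Dtest_mem_Icc (f g : Measure BinSeq) (t : ℕ) (ω : BinSeq) :
    Dtest f g t ω ∈ Icc (0 : ℝ) 1 := by
  cases t with
  | zero => simp only [Dtest]; norm_num
  | succ t =>
    simp only [Dtest]
    split_ifs
    · exact ⟨by positivity, div_le_one_of_le₀ (by simp) (by positivity)⟩
    · norm_num

lemma setIntegral_Dtest_cyl (f g : Measure BinSeq) [IsFiniteMeasure f] [IsFiniteMeasure g]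
    (t : ℕ) (ω : BinSeq) :
    ∫ ω' in cyl ω t, Dtest f g (t + 1) ω' ∂(f + g) = f.real (cyl ω t) := by
  by_cases h : (f + g) (cyl ω t) = 0
  · have hf : f (cyl ω t) = 0 := (add_eq_zero.1 (by simpa using h)).1
    rw [setIntegral_measure_zero _ h, Measure.real, hf, ENNReal.toReal_zero]
  have hmeas : MeasurableSet (cyl ω t) := by
    rw [cyl_eq_preimage]
    exact measurable_initialSegment t (measurableSet_singleton _)
  have hconst : EqOn (Dtest f g (t + 1))
      (fun _ => f.real (cyl ω t) / (f + g).real (cyl ω t)) (cyl ω t) := by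
    intro ω' hω'
    obtain ⟨φ, hφ⟩ := Dtest_succ_eq_comp f g t
    have hseg : (fun i : Fin t => ω' i) = fun i : Fin t => ω i := funext fun i => hω' i i.2
    rw [← Dtest_succ f g t ω h, hφ, Function.comp_apply, Function.comp_apply, hseg]
  rw [setIntegral_congr_fun hmeas hconst, setIntegral_const, smul_eq_mul,
    mul_div_cancel₀]
  exact (measureReal_ne_zero_iff).2 h

lemma measurable_Dtest_succ (f g : Measure BinSeq) (t : ℕ) :
    Measurable[coordFiltration t] (Dtest f g (t + 1)) := by
  obtain ⟨φ, hφ⟩ := Dtest_succ_eq_comp f g t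
  rw [hφ]
  exact (measurable_of_finite φ).comp (comap_measurable _)

lemma integrable_Dtest_succ (f g μ : Measure BinSeq) [IsFiniteMeasure μ] (t : ℕ) :
    Integrable (Dtest f g (t + 1)) μ := by
  refine Integrable.of_bound
    ((measurable_Dtest_succ f g t).mono (coordFiltration.le t) le_rfl).aestronglyMeasurable
    1 (ae_of_all _ fun ω => ?_)
  obtain ⟨h0, h1⟩ := Dtest_mem_Icc f g (t + 1) ω
  rwa [Real.norm_of_nonneg h0]

lemma Dtest_succ_ae_eq_condExp (f g : Measure BinSeq) [IsFiniteMeasure f] [IsFiniteMeasure g]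
    (t : ℕ) :
    Dtest f g (t + 1) =ᵐ[f + g]
      (f + g)[fun ω => (f.rnDeriv (f + g) ω).toReal | coordFiltration t] := by
  have hac : f ≪ f + g := Measure.absolutelyContinuous_of_le (Measure.le_add_right le_rfl)
  refine ae_eq_condExp_of_forall_setIntegral_eq (coordFiltration.le t)
    Measure.integrable_toReal_rnDeriv
    (fun s _ _ => (integrable_Dtest_succ f g _ t).integrableOn) ?_
    (measurable_Dtest_succ f g t).stronglyMeasurable.aestronglyMeasurable
  rintro s ⟨S, -, rfl⟩ -
  let C : (Fin t → Bool) → Set BinSeq :=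
    fun x => (fun (ω : BinSeq) (i : Fin t) => ω i) ⁻¹' {x}
  have hC : ∀ x, MeasurableSet (C x) := fun x =>
    measurable_initialSegment t (measurableSet_singleton x)
  have hdisj : PairwiseDisjoint (S.toFinite.toFinset : Set (Fin t → Bool)) C :=
    fun x _ y _ hxy => Disjoint.preimage _ (disjoint_singleton.2 hxy)
  have hunion : (fun (ω : BinSeq) (i : Fin t) => ω i) ⁻¹' S = ⋃ x ∈ S.toFinite.toFinset, C x := by
    ext ω
    simp [C]
  rw [Measure.setIntegral_toReal_rnDeriv hac, hunion,
    integral_biUnion_finset _ (fun x _ => hC x) hdisj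
      (fun x _ => (integrable_Dtest_succ f g _ t).integrableOn),
    measureReal_biUnion_finset hdisj (fun x _ => hC x)]
  refine Finset.sum_congr rfl fun x _ => ?_
  have hx : C x = cyl (fun i => if h : i < t then x ⟨i, h⟩ else false) t := by
    rw [cyl_eq_preimage]
    simp [C]
  rw [hx, setIntegral_Dtest_cyl]

lemma ae_tendsto_Dtest (f g : Measure BinSeq) [IsFiniteMeasure f] [IsFiniteMeasure g] :
    ∀ᵐ ω ∂(f + g),
      Tendsto (fun t => Dtest f g t ω) atTop (nhds (f.rnDeriv (f + g) ω).toReal) := by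
  have hlevy := Integrable.tendsto_ae_condExp (μ := f + g) (ℱ := coordFiltration)
    (g := fun ω => (f.rnDeriv (f + g) ω).toReal) Measure.integrable_toReal_rnDeriv (by
      rw [iSup_coordFiltration]
      exact (Measure.measurable_rnDeriv f (f + g)).ennreal_toReal.stronglyMeasurable)
  filter_upwards [hlevy, ae_all_iff.2 (Dtest_succ_ae_eq_condExp f g)] with ω hω hD
  rw [← tendsto_add_atTop_iff_nat 1]
  simpa only [hD] using hω

lemma Dtest_swap (f g : Measure BinSeq) [IsFiniteMeasure f] [IsFiniteMeasure g] (t : ℕ)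
    (ω : BinSeq) : Dtest f g t ω = 1 - Dtest g f t ω := by
  cases t with
  | zero => simp only [Dtest]; norm_num
  | succ t =>
    simp only [Dtest, add_comm (g (cyl ω t))]
    split_ifs with h
    · have hpos : 0 < (f (cyl ω t)).toReal + (g (cyl ω t)).toReal := by
        rw [← ENNReal.toReal_add (by finiteness) (by finiteness)]
        exact ENNReal.toReal_pos h.ne' (by finiteness)
      rw [add_comm (g (cyl ω t)).toReal]
      field_simp
      ring
    · norm_num

lemma LSet_Dtest_eq_RSet (f g : Measure BinSeq) [IsFiniteMeasure f] [IsFiniteMeasure g]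
    (ε : ℝ) : LSet Dtest f g ε = RSet Dtest g f (1 - ε) := by
  ext ω
  constructor
  · rintro ⟨l, hl, hε⟩
    refine ⟨1 - l, ?_, by linarith⟩
    simpa only [Dtest_swap g f] using hl.const_sub 1
  · rintro ⟨l, hl, hε⟩
    refine ⟨1 - l, ?_, by linarith⟩
    simpa only [Dtest_swap f g] using hl.const_sub 1

lemma measure_inter_RSet_Dtest_pos (f g : Measure BinSeq) [IsFiniteMeasure f]
    [IsFiniteMeasure g] {A : Set BinSeq} (hA : MeasurableSet A) {ε : ℝ} (hε : ε ∈ Ioo (0 : ℝ) 1)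
    (hfA : f A < ENNReal.ofReal (ε / (1 - ε)) * g A) : 0 < g (A ∩ RSet Dtest f g ε) := by
  obtain ⟨hε0, hε1⟩ := hε
  by_contra hcon
  have hzero : g (A ∩ RSet Dtest f g ε) = 0 := by simpa using hcon
  have hac : f ≪ f + g := Measure.absolutelyContinuous_of_le (Measure.le_add_right le_rfl)
  have hac' : g ≪ f + g := Measure.absolutelyContinuous_of_le (Measure.le_add_left le_rfl)
  set h : BinSeq → ℝ := fun ω => (f.rnDeriv (f + g) ω).toReal
  have hh : Measurable h := (Measure.measurable_rnDeriv f (f + g)).ennreal_toReal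
  set B := A ∩ {ω | ε ≤ h ω}
  have hB : MeasurableSet B := hA.inter (measurableSet_le measurable_const hh)
  have hAB : g A = g B := by
    refine measure_congr ?_
    filter_upwards [hac'.ae_le (ae_tendsto_Dtest f g), measure_eq_zero_iff_ae_notMem.1 hzero]
      with ω hω hnot
    refine propext ⟨fun hωA => ⟨hωA, ?_⟩, fun hωB => hωB.1⟩
    by_contra hlt
    exact hnot ⟨hωA, _, hω, not_le.1 hlt⟩
  have hle : ε * (f + g).real B ≤ f.real B := by
    rw [← Measure.setIntegral_toReal_rnDeriv hac]
    exact setIntegral_ge_of_const_le_real hB (by finiteness) (fun ω hω => hω.2)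
      Measure.integrable_toReal_rnDeriv.integrableOn
  rw [measureReal_add_apply] at hle
  refine hfA.not_ge ?_
  rw [hAB]
  refine le_trans ?_ (measure_mono (inter_subset_left : B ⊆ A))
  rw [← ofReal_measureReal (μ := f), ← ofReal_measureReal (μ := g),
    ← ENNReal.ofReal_mul (div_nonneg hε0.le (by linarith))]
  refine ENNReal.ofReal_le_ofReal ?_
  rw [div_mul_eq_mul_div, div_le_iff₀ (by linarith)]
  linarith

/-- The finite derivative test is reasonable. -/
theorem stmt2 : Reasonable Dtest := by
  intro f g _ _ A hA
  refine ⟨fun ε hε _ hfA => ?_, fun ε hε _ hgA => ?_⟩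
  · exact measure_inter_RSet_Dtest_pos f g hA ⟨hε.1, by linarith [hε.2]⟩ hfA
  · rw [LSet_Dtest_eq_RSet]
    refine measure_inter_RSet_Dtest_pos g f hA ⟨by linarith [hε.2], by linarith [hε.1]⟩ ?_
    rwa [sub_sub_cancel]
end

section
/- Define the likelihood-ratio test L by L_{t+1}(ω,f,g) = 0 if g([ω^t]) > f([ω^t]), L_{t+1}(ω,f,g) = 1 if g([ω^t]) < f([ω^t]), and L_{t+1}(ω,f,g) = 1/2 if g([ω^t]) = f([ω^t]). Then L is an anonymous and reasonable cardinal comparison test, but L is not error-free; moreover its error is arbitrarily large: for every ε ∈ (1/2,1) there exist probability measures f, g on Ω^∞ and a measurable set A with g(A ∩ L_{L,ε}^{(f,g)}) > ((1−ε)/ε)·f(A ∩ L_{L,ε}^{(f,g)}). -/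
open MeasureTheory Filter Set
open scoped ENNReal

/-- The likelihood-ratio test of Al-Najjar and Weinstein. -/
noncomputable def Ltest : Test := fun f g t ω =>
  match t with
  | 0 => 1/2
  | Nat.succ s =>
      if f (cyl ω s) < g (cyl ω s) then 0
      else if g (cyl ω s) < f (cyl ω s) then 1
      else 1/2

lemma cyl_congr {ω ω' : BinSeq} {t : ℕ} (h : ∀ i < t, ω i = ω' i) : cyl ω t = cyl ω' t :=
  (PiNat.mem_cylinder_iff_eq (E := fun _ => Bool)).1 h

lemma countable_setOf_cyl : {C : Set BinSeq | ∃ ω t, C = cyl ω t}.Countable := by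
  refine (Set.countable_range (fun p : Σ n : ℕ, (Fin n → Bool) =>
    cyl (fun i => if h : i < p.1 then p.2 ⟨i, h⟩ else false) p.1)).mono ?_
  rintro C ⟨ω, t, rfl⟩
  refine ⟨⟨t, fun i => ω i⟩, cyl_congr fun i hi => ?_⟩
  simp [hi]

lemma exists_cyl_subset {U : Set BinSeq} (hU : IsOpen U) {ω : BinSeq} (hω : ω ∈ U) :
    ∃ n, ∀ t, n ≤ t → cyl ω t ⊆ U := by
  obtain ⟨V, ⟨x, n, rfl⟩, hxV, hVU⟩ :=
    (PiNat.isTopologicalBasis_cylinders (fun _ : ℕ => Bool)).exists_subset_of_mem_open hω hU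
  refine ⟨n, fun t ht => ?_⟩
  rw [← PiNat.mem_cylinder_iff_eq.1 hxV] at hVU
  exact (PiNat.cylinder_anti ω ht).trans hVU

/-- If every point of `B` lies in arbitrarily small cylinders on which `g ≤ f`,
then `g B ≤ f B`. -/
lemma measure_le_of_frequently_cyl_le (f g : Measure BinSeq) [IsFiniteMeasure f]
    {B : Set BinSeq} (hB : ∀ ω ∈ B, ∃ᶠ t in atTop, g (cyl ω t) ≤ f (cyl ω t)) :
    g B ≤ f B := by
  refine le_of_forall_gt fun r hr => ?_
  obtain ⟨U, hBU, hU, hfU⟩ := B.exists_isOpen_lt_of_lt r hr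
  refine lt_of_le_of_lt ?_ hfU
  let Q : BinSeq → ℕ → Prop := fun ω t => cyl ω t ⊆ U ∧ g (cyl ω t) ≤ f (cyl ω t)
  let S : Set (Set BinSeq) :=
    {C | ∃ ω t, C = cyl ω t ∧ Q ω t ∧ ∀ s < t, ¬ Q ω s}
  have hScount : S.Countable :=
    countable_setOf_cyl.mono <| by
      rintro C ⟨ω, t, hC, -⟩
      exact ⟨ω, t, hC⟩
  have hSmeas : ∀ C ∈ S, MeasurableSet C := by
    rintro C ⟨ω, t, rfl, -⟩
    exact (PiNat.isOpen_cylinder (fun _ : ℕ => Bool) ω t).measurableSet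
  have hBS : B ⊆ ⋃₀ S := by
    intro ω hω
    obtain ⟨n, hn⟩ := exists_cyl_subset hU (hBU hω)
    obtain ⟨t, ht, hle⟩ := frequently_atTop.1 (hB ω hω) n
    have hex : ∃ t, Q ω t := ⟨t, hn t ht, hle⟩
    classical
    exact ⟨cyl ω (Nat.find hex), ⟨ω, _, rfl, Nat.find_spec hex, fun s hs => Nat.find_min hex hs⟩,
      fun i _ => rfl⟩
  have hdisj : S.PairwiseDisjoint id := by
    have key : ∀ ω s ω' t, s ≤ t → Q ω s → (∀ r < t, ¬ Q ω' r) →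
        ¬ Disjoint (cyl ω s) (cyl ω' t) → cyl ω s = cyl ω' t := by
      intro ω s ω' t hst hs ht hnd
      obtain ⟨x, hx, hx'⟩ := Set.not_disjoint_iff.1 hnd
      have heq : cyl ω s = cyl ω' s :=
        cyl_congr fun i hi => (hx i hi).symm.trans (hx' i (hi.trans_le hst))
      rcases hst.lt_or_eq with h | rfl
      · refine absurd ?_ (ht s h)
        simpa only [Q, heq] using hs
      · exact heq
    rintro C ⟨ω, s, rfl, hs, hs'⟩ D ⟨ω', t, rfl, ht, ht'⟩ hne
    by_contra hnd
    rcases le_total s t with h | h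
    · exact hne (key ω s ω' t h hs ht' hnd)
    · exact hne (key ω' t ω s h ht hs' fun hd => hnd hd.symm).symm
  calc g B ≤ g (⋃₀ S) := measure_mono hBS
    _ = ∑' C : S, g C := measure_sUnion hScount hdisj hSmeas
    _ ≤ ∑' C : S, f C := ENNReal.tsum_le_tsum <| by
        rintro ⟨C, ω, t, rfl, hQ, -⟩
        exact hQ.2
    _ = f (⋃₀ S) := (measure_sUnion hScount hdisj hSmeas).symm
    _ ≤ f U := measure_mono <| by
        rintro x ⟨C, ⟨ω, t, rfl, hQ, -⟩, hx⟩
        exact hQ.1 hx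

lemma Ltest_succ (f g : Measure BinSeq) (t : ℕ) (ω : BinSeq) :
    Ltest f g (t + 1) ω = if f (cyl ω t) < g (cyl ω t) then 0
      else if g (cyl ω t) < f (cyl ω t) then 1 else 1 / 2 := rfl

lemma mem_RSet_Ltest {f g : Measure BinSeq} {ω : BinSeq} {ε : ℝ} (hε : 0 < ε)
    (h : ∀ᶠ t in atTop, f (cyl ω t) < g (cyl ω t)) : ω ∈ RSet Ltest f g ε := by
  refine ⟨0, (tendsto_add_atTop_iff_nat 1).1 (tendsto_const_nhds.congr' ?_), hε⟩
  filter_upwards [h] with t ht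
  rw [Ltest_succ, if_pos ht]

lemma mem_LSet_Ltest {f g : Measure BinSeq} {ω : BinSeq} {ε : ℝ} (hε : ε < 1)
    (h : ∀ᶠ t in atTop, g (cyl ω t) < f (cyl ω t)) : ω ∈ LSet Ltest f g ε := by
  refine ⟨1, (tendsto_add_atTop_iff_nat 1).1 (tendsto_const_nhds.congr' ?_), hε⟩
  filter_upwards [h] with t ht
  rw [Ltest_succ, if_neg ht.not_gt, if_pos ht]

/-- A set with `f A < g A` has a `g`-nonnull part on which eventually `f < g` on cylinders. -/
lemma measure_inter_pos_of_lt {f g : Measure BinSeq} [IsFiniteMeasure f] {A R : Set BinSeq}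
    (hR : ∀ ω, (∀ᶠ t in atTop, f (cyl ω t) < g (cyl ω t)) → ω ∈ R) (h : f A < g A) :
    0 < g (A ∩ R) := by
  refine pos_iff_ne_zero.2 fun h0 => h.not_ge ?_
  have hdiff : g (A \ R) ≤ f (A \ R) := measure_le_of_frequently_cyl_le f g fun ω hω => by
    have := mt (hR ω) hω.2
    simpa only [not_eventually, not_lt] using this
  calc g A ≤ g (A ∩ R) + g (A \ R) := measure_le_inter_add_sdiff g A R
    _ = g (A \ R) := by rw [h0, zero_add]
    _ ≤ f (A \ R) := hdiff
    _ ≤ f A := measure_mono sdiff_subset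

lemma lt_of_lt_ofReal_mul {a b : ℝ≥0∞} {c : ℝ} (hc : c ≤ 1) (h : a < ENNReal.ofReal c * b) :
    a < b :=
  h.trans_le (mul_le_of_le_one_left zero_le (ENNReal.ofReal_le_one.2 hc))

lemma isCCTest_Ltest : IsCCTest Ltest := by
  intro f g _ _ t ht
  obtain ⟨t, rfl⟩ := Nat.exists_eq_add_of_le' ht
  refine ⟨fun ω => ?_, ?_⟩
  · rw [Ltest_succ]
    split_ifs <;> norm_num
  · let F : (Fin (t + 1) → Bool) → ℝ := fun u =>
      Ltest f g (t + 1) (fun i => if h : i < t + 1 then u ⟨i, h⟩ else false)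
    have hF : Ltest f g (t + 1) = F ∘ fun ω (i : Fin (t + 1)) => ω (i : ℕ) := by
      ext ω
      have hcyl : cyl ω t = cyl (fun i => if _ : i < t + 1 then ω i else false) t :=
        cyl_congr fun i hi => by simp [hi.le]
      simp only [F, Function.comp_apply, Ltest_succ, ← hcyl]
    rw [hF]
    exact (measurable_of_finite F).comp (comap_measurable _)

lemma anonymous_Ltest : Anonymous Ltest := by
  intro f g _ _ t ht ω
  obtain ⟨t, rfl⟩ := Nat.exists_eq_add_of_le' ht
  rw [Ltest_succ, Ltest_succ]
  rcases lt_trichotomy (f (cyl ω t)) (g (cyl ω t)) with h | h | h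
  · simp [h, h.not_gt]
  · simp [h]; norm_num
  · simp [h, h.not_gt]

lemma reasonable_Ltest : Reasonable Ltest := by
  intro f g _ _ A _
  refine ⟨fun ε hε _ h => ?_, fun ε hε _ h => ?_⟩
  · refine measure_inter_pos_of_lt (fun ω => mem_RSet_Ltest hε.1) (lt_of_lt_ofReal_mul ?_ h)
    rw [div_le_one] <;> linarith [hε.2]
  · refine measure_inter_pos_of_lt (fun ω => mem_LSet_Ltest hε.2) (lt_of_lt_ofReal_mul ?_ h)
    rw [div_le_one] <;> linarith [hε.1]

lemma Ltest_error_large {ε : ℝ} (hε : ε ∈ Set.Ioo (1 / 2) 1) :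
    ∃ f g : Measure BinSeq, IsProbabilityMeasure f ∧ IsProbabilityMeasure g ∧
      ∃ A : Set BinSeq, MeasurableSet A ∧
        ENNReal.ofReal ((1 - ε) / ε) * f (A ∩ LSet Ltest f g ε) <
          g (A ∩ LSet Ltest f g ε) := by
  have hc : ENNReal.ofReal ((1 - ε) / ε) < 1 := by
    rw [ENNReal.ofReal_lt_one, div_lt_one] <;> linarith [hε.1]
  obtain ⟨q, hcq, hq⟩ := exists_between hc
  let x : BinSeq := fun _ => true
  let y : BinSeq := fun _ => false
  let f : Measure BinSeq := Measure.dirac x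
  let g : Measure BinSeq := q • Measure.dirac x + (1 - q) • Measure.dirac y
  have hg : IsProbabilityMeasure g := ⟨by simp [g, add_tsub_cancel_of_le hq.le]⟩
  have hx : x ∈ LSet Ltest f g ε := by
    refine mem_LSet_Ltest hε.2 (eventually_atTop.2 ⟨1, fun t ht => ?_⟩)
    have hxt : x ∈ cyl x t := fun _ _ => rfl
    have hyt : y ∉ cyl x t := fun h => Bool.false_ne_true (h 0 ht)
    have hm : MeasurableSet (cyl x t) :=
      (PiNat.isOpen_cylinder (fun _ : ℕ => Bool) x t).measurableSet
    simpa [f, g, hm, hxt, hyt] using hq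
  refine ⟨f, g, inferInstance, hg, {x}, measurableSet_singleton x, ?_⟩
  rw [inter_eq_left.2 (singleton_subset_iff.2 hx)]
  have hxy : y ≠ x := fun h => Bool.false_ne_true (congrFun h 0)
  simpa [f, g, hxy] using hcq

lemma not_errorFree_Ltest : ¬ ErrorFree Ltest := by
  intro h
  have hε : (3 / 4 : ℝ) ∈ Set.Ioo (1 / 2) 1 := by norm_num
  obtain ⟨f, g, hf, hg, A, hA, hlt⟩ := Ltest_error_large hε
  exact hlt.not_ge ((h f g hf hg A hA).2 _ hε)

/-- `L` is an anonymous and reasonable cardinal comparison test, it is not error-free, and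
its error is arbitrarily large. -/
theorem stmt11 :
    IsCCTest Ltest ∧ Anonymous Ltest ∧ Reasonable Ltest ∧ ¬ ErrorFree Ltest ∧
    ∀ ε : ℝ, ε ∈ Set.Ioo (1/2) 1 →
      ∃ f g : Measure BinSeq, IsProbabilityMeasure f ∧ IsProbabilityMeasure g ∧
        ∃ A : Set BinSeq, MeasurableSet A ∧
          ENNReal.ofReal ((1 - ε) / ε) * f (A ∩ LSet Ltest f g ε) <
            g (A ∩ LSet Ltest f g ε) := by
  exact ⟨isCCTest_Ltest, anonymous_Ltest, reasonable_Ltest, not_errorFree_Ltest,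
    fun _ => Ltest_error_large⟩
end

section
/- Let 𝒜 be a set of probability measures on Ω^∞ containing two distinct measures f ≠ g such that g is absolutely continuous with respect to f (or f is absolutely continuous with respect to g). Then there exists no cardinal comparison test that is ideal with respect to 𝒜. -/
open MeasureTheory Filter Set
open scoped ENNReal

/-- A test is ideal with respect to a set `𝒜` of (probability) measures if whenever the two
experts use distinct measures from `𝒜`, each surely believes the test will be decisive on
himself. -/
def IdealWrt (T : Test) (𝒜 : Set (Measure BinSeq)) : Prop :=
  ∀ f g : Measure BinSeq, f ∈ 𝒜 → g ∈ 𝒜 → f ≠ g →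
    f {ω | Tendsto (fun t => T f g t ω) atTop (nhds 1)} = 1 ∧
    g {ω | Tendsto (fun t => T f g t ω) atTop (nhds 0)} = 1

lemma coordAlg_le (t : ℕ) : coordAlg t ≤ (inferInstance : MeasurableSpace BinSeq) :=
  Measurable.comap_le (by fun_prop)

lemma IsCCTest.measurableSet_tendsto {T : Test} (hT : IsCCTest T) (f g : Measure BinSeq)
    (hf : IsProbabilityMeasure f) (hg : IsProbabilityMeasure g) (a : ℝ) :
    MeasurableSet {ω | Tendsto (fun t => T f g t ω) atTop (nhds a)} := by
  have h : ∀ t, Measurable (T f g (t + 1)) := fun t =>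
    (hT f g hf hg (t + 1) (by omega)).2.mono (coordAlg_le _) le_rfl
  have hset : {ω | Tendsto (fun t => T f g t ω) atTop (nhds a)} =
      {ω | Tendsto (fun t => T f g (t + 1) ω) atTop (nhds a)} := by
    ext ω
    exact (tendsto_add_atTop_iff_nat (f := fun t => T f g t ω) 1).symm
  rw [hset]
  exact _root_.measurableSet_tendsto (nhds a) h

/-- A measurable set of full measure has full measure under any absolutely continuous
probability measure, so it meets every set of full measure for the latter. -/
lemma inter_nonempty_of_absolutelyContinuous {α : Type*} [MeasurableSpace α] {μ ν : Measure α}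
    [IsProbabilityMeasure μ] (hνμ : ν ≪ μ) {A B : Set α} (hA : MeasurableSet A)
    (hμA : μ A = 1) (hνB : ν B = 1) : (A ∩ B).Nonempty := by
  by_contra h
  have hBA : B ⊆ Aᶜ := fun x hB hA => h ⟨x, hA, hB⟩
  have hνA : ν Aᶜ = 0 := hνμ ((prob_compl_eq_zero_iff hA).2 hμA)
  have : ν B = 0 := measure_mono_null hBA hνA
  simp [hνB] at this

/-- No cardinal comparison test is ideal with respect to a set containing two distinct
measures one of which is absolutely continuous with respect to the other. -/
theorem stmt14 (𝒜 : Set (Measure BinSeq)) (h𝒜 : ∀ μ ∈ 𝒜, IsProbabilityMeasure μ)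
    (f g : Measure BinSeq) (hf : f ∈ 𝒜) (hg : g ∈ 𝒜) (hne : f ≠ g)
    (hac : g ≪ f ∨ f ≪ g) :
    ¬ ∃ T : Test, IsCCTest T ∧ IdealWrt T 𝒜 := by
  rintro ⟨T, hT, hI⟩
  have := h𝒜 f hf
  have := h𝒜 g hg
  obtain ⟨h1, h0⟩ := hI f g hf hg hne
  rcases hac with h | h
  · obtain ⟨ω, hω1, hω0⟩ := inter_nonempty_of_absolutelyContinuous h
      (hT.measurableSet_tendsto f g ‹_› ‹_› 1) h1 h0
    exact one_ne_zero (tendsto_nhds_unique hω1 hω0)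
  · obtain ⟨ω, hω0, hω1⟩ := inter_nonempty_of_absolutelyContinuous h
      (hT.measurableSet_tendsto f g ‹_› ‹_› 0) h0 h1
    exact one_ne_zero (tendsto_nhds_unique hω1 hω0)
end

section
/- If T is a reasonable cardinal comparison test, then for all probability measures f, g on Ω^∞, every ε ∈ (1/2,1) and every measurable set A ⊆ Ω^∞: f(A ∩ R_{T,ε}^{(f,g)}) > 0 implies g(A ∩ R_{T,ε}^{(f,g)}) > 0; and symmetrically, for every ε ∈ (0,1/2): g(A ∩ L_{T,ε}^{(f,g)}) > 0 implies f(A ∩ L_{T,ε}^{(f,g)}) > 0. -/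
open MeasureTheory Filter Set
open scoped ENNReal

/-- Each section of a cardinal comparison test at a positive time is measurable. -/
lemma IsCCTest.measurable {T : Test} (hT : IsCCTest T) (f g : Measure BinSeq)
    [IsProbabilityMeasure f] [IsProbabilityMeasure g] (t : ℕ) :
    Measurable (T f g (t + 1)) := by
  have hle : coordAlg (t + 1) ≤ (inferInstance : MeasurableSpace BinSeq) :=
    Measurable.comap_le (by fun_prop)
  exact (hT f g inferInstance inferInstance (t + 1) (Nat.le_add_left 1 t)).2.mono hle le_rfl

/-- The set where a sequence of measurable functions converges to a limit in a measurable set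
is measurable. -/
lemma measurableSet_exists_tendsto_mem {Ω : Type*} [MeasurableSpace Ω] {u : ℕ → Ω → ℝ}
    (hu : ∀ n, Measurable (u n)) {s : Set ℝ} (hs : MeasurableSet s) :
    MeasurableSet {ω | ∃ l : ℝ, Tendsto (fun n => u n ω) atTop (nhds l) ∧ l ∈ s} := by
  have heq : {ω | ∃ l : ℝ, Tendsto (fun n => u n ω) atTop (nhds l) ∧ l ∈ s} =
      {ω | ∃ l : ℝ, Tendsto (fun n => u n ω) atTop (nhds l)} ∩
        (fun ω => limsup (fun n => u n ω) atTop) ⁻¹' s := by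
    ext ω
    constructor
    · rintro ⟨l, hl, hls⟩
      exact ⟨⟨l, hl⟩, by simpa only [mem_preimage, hl.limsup_eq] using hls⟩
    · rintro ⟨⟨l, hl⟩, hls⟩
      exact ⟨l, hl, by simpa only [mem_preimage, hl.limsup_eq] using hls⟩
  rw [heq]
  exact (measurableSet_exists_tendsto hu).inter (Measurable.limsup hu hs)

lemma IsCCTest.measurableSet_RSet {T : Test} (hT : IsCCTest T) (f g : Measure BinSeq)
    [IsProbabilityMeasure f] [IsProbabilityMeasure g] (ε : ℝ) :
    MeasurableSet (RSet T f g ε) := by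
  have h := measurableSet_exists_tendsto_mem (hT.measurable f g) (measurableSet_Iio (a := ε))
  have hshift (ω : BinSeq) (l : ℝ) := tendsto_add_atTop_iff_nat (f := fun t => T f g t ω)
    (l := nhds l) 1
  simpa only [RSet, mem_Iio, hshift] using h

lemma IsCCTest.measurableSet_LSet {T : Test} (hT : IsCCTest T) (f g : Measure BinSeq)
    [IsProbabilityMeasure f] [IsProbabilityMeasure g] (ε : ℝ) :
    MeasurableSet (LSet T f g ε) := by
  have h := measurableSet_exists_tendsto_mem (hT.measurable f g) (measurableSet_Ioi (a := ε))
  have hshift (ω : BinSeq) (l : ℝ) := tendsto_add_atTop_iff_nat (f := fun t => T f g t ω)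
    (l := nhds l) 1
  simpa only [LSet, mem_Ioi, hshift] using h

lemma disjoint_RSet_LSet (T : Test) (f g : Measure BinSeq) (ε : ℝ) :
    Disjoint (RSet T f g ε) (LSet T f g ε) := by
  rw [Set.disjoint_left]
  rintro ω ⟨l, hl, hlt⟩ ⟨m, hm, hmt⟩
  rw [tendsto_nhds_unique hl hm] at hlt
  exact lt_asymm hlt hmt

/-- For a reasonable test: if `f` gives positive probability to `A ∩ R_{T,ε}` for
`ε ∈ (1/2,1)`, so does `g`; symmetrically for `L`-sets with `ε ∈ (0,1/2)`. -/
theorem stmt18 (T : Test) (hT : IsCCTest T) (hReas : Reasonable T)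
    (f g : Measure BinSeq) [IsProbabilityMeasure f] [IsProbabilityMeasure g]
    (A : Set BinSeq) (hA : MeasurableSet A) :
    (∀ ε : ℝ, ε ∈ Set.Ioo (1/2) 1 →
      0 < f (A ∩ RSet T f g ε) → 0 < g (A ∩ RSet T f g ε)) ∧
    (∀ ε : ℝ, ε ∈ Set.Ioo 0 (1/2) →
      0 < g (A ∩ LSet T f g ε) → 0 < f (A ∩ LSet T f g ε)) := by
  constructor
  · rintro ε ⟨h₁, h₂⟩ hf
    by_contra hg
    have hg0 : g (A ∩ RSet T f g ε) = 0 := nonpos_iff_eq_zero.mp (not_lt.mp hg)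
    have hc : 0 < ENNReal.ofReal ((1 - ε) / ε) :=
      ENNReal.ofReal_pos.mpr (div_pos (by linarith) (by linarith))
    have h := (hReas f g inferInstance inferInstance _
      (hA.inter (hT.measurableSet_RSet f g ε))).2 ε ⟨h₁, h₂⟩ hf
      (by rw [hg0]; exact ENNReal.mul_pos hc.ne' hf.ne')
    rw [inter_assoc, (disjoint_RSet_LSet T f g ε).inter_eq, inter_empty, measure_empty] at h
    exact lt_irrefl _ h
  · rintro ε ⟨h₁, h₂⟩ hg
    by_contra hf
    have hf0 : f (A ∩ LSet T f g ε) = 0 := nonpos_iff_eq_zero.mp (not_lt.mp hf)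
    have hc : 0 < ENNReal.ofReal (ε / (1 - ε)) :=
      ENNReal.ofReal_pos.mpr (div_pos (by linarith) (by linarith))
    have h := (hReas f g inferInstance inferInstance _
      (hA.inter (hT.measurableSet_LSet f g ε))).1 ε ⟨h₁, h₂⟩ hg
      (by rw [hf0]; exact ENNReal.mul_pos hc.ne' hg.ne')
    rw [inter_assoc, (disjoint_RSet_LSet T f g ε).symm.inter_eq, inter_empty, measure_empty] at h
    exact lt_irrefl _ h
end
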